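/- Let η ∈ (0,1), Δ > 0, C₁ > 0, and let S : [0,T] → ℝ be measurable with 0 ≤ Y ≤ S(τ) ≤ X for all τ ∈ [0,T], where 0 ≤ Y ≤ X. Then for every t ∈ [0,T], |∫₀ᵗ min{C₁, S(τ)} u_Δ(τ) dτ − η ∫₀ᵗ min{C₁, S(τ)} dτ| ≤ min{C₁, X − Y} η t + η(1−η) Δ min{C₁, X}. -/

import Mathlib

/-- The Δ-periodic on-and-off traffic signal with split η: equal to 1 (green)
during the first ηΔ of each cycle of length Δ, and 0 (red) otherwise. -/
noncomputable def uOnOff (Δ η τ : ℝ) : ℝ :=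
  if τ - Δ * (⌊τ / Δ⌋ : ℝ) < η * Δ then 1 else 0

section OnOffSignal

variable {Δ η : ℝ}

theorem measurable_uOnOff (Δ η : ℝ) : Measurable (uOnOff Δ η) := by
  unfold uOnOff
  refine Measurable.ite (measurableSet_lt ?_ measurable_const) measurable_const measurable_const
  fun_prop

theorem uOnOff_eq_zero_or_one (Δ η τ : ℝ) : uOnOff Δ η τ = 0 ∨ uOnOff Δ η τ = 1 := by
  unfold uOnOff
  split_ifs <;> simp

theorem intervalIntegrable_of_abs_le {f : ℝ → ℝ} {a b C : ℝ} (hab : a ≤ b) (hf : Measurable f)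
    (hC : ∀ x ∈ Set.Ioc a b, |f x| ≤ C) :
    IntervalIntegrable f MeasureTheory.volume a b := by
  rw [intervalIntegrable_iff_integrableOn_Ioc_of_le hab]
  exact MeasureTheory.IntegrableOn.of_bound measure_Ioc_lt_top hf.aestronglyMeasurable C
    ((MeasureTheory.ae_restrict_iff' measurableSet_Ioc).2 (.of_forall hC))

theorem intervalIntegrable_uOnOff (Δ η a b : ℝ) :
    IntervalIntegrable (uOnOff Δ η) MeasureTheory.volume a b := by
  have hbound : ∀ x, |uOnOff Δ η x| ≤ 1 := fun x => by
    rcases uOnOff_eq_zero_or_one Δ η x with h | h <;> simp [h]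
  rcases le_total a b with h | h
  · exact intervalIntegrable_of_abs_le h (measurable_uOnOff Δ η) fun x _ => hbound x
  · exact (intervalIntegrable_of_abs_le h (measurable_uOnOff Δ η) fun x _ => hbound x).symm

theorem uOnOff_natCast_mul_add (hΔ : 0 < Δ) (k : ℕ) {s : ℝ} (hs : s ∈ Set.Ico 0 Δ) :
    uOnOff Δ η (k * Δ + s) = if s < η * Δ then 1 else 0 := by
  have hfloor : ⌊(k * Δ + s) / Δ⌋ = (k : ℤ) := by
    rw [Int.floor_eq_iff, le_div_iff₀ hΔ, div_lt_iff₀ hΔ]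
    push_cast
    constructor <;> linarith [hs.1, hs.2]
  unfold uOnOff
  rw [hfloor]
  push_cast
  rw [show (k : ℝ) * Δ + s - Δ * k = s by ring]

theorem integral_uOnOff_cycle (hη : η ∈ Set.Ioo (0 : ℝ) 1) (hΔ : 0 < Δ) (k : ℕ) {s : ℝ}
    (hs : s ∈ Set.Icc 0 Δ) :
    ∫ τ in (k * Δ)..(k * Δ + s), uOnOff Δ η τ = min s (η * Δ) := by
  have hηΔ : 0 < η * Δ := mul_pos hη.1 hΔ
  have hgreen : ∀ r, 0 ≤ r → r ≤ η * Δ → r ≤ Δ →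
      ∫ τ in (k * Δ)..(k * Δ + r), uOnOff Δ η τ = r := by
    intro r hr hrη hrΔ
    rw [intervalIntegral.integral_congr_uIoo (g := fun _ => 1)]
    · simp
    · intro τ hτ
      rw [Set.uIoo_of_le (by linarith)] at hτ
      have h := uOnOff_natCast_mul_add (η := η) hΔ k (s := τ - k * Δ)
        ⟨by linarith [hτ.1], by linarith [hτ.2]⟩
      rw [add_sub_cancel, if_pos (by linarith [hτ.2])] at h
      exact h
  rcases le_total s (η * Δ) with h | h
  · rw [min_eq_left h, hgreen s hs.1 h hs.2]
  · rw [min_eq_right h, ← intervalIntegral.integral_add_adjacent_intervals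
      (intervalIntegrable_uOnOff Δ η _ (k * Δ + η * Δ)) (intervalIntegrable_uOnOff Δ η _ _),
      hgreen _ hηΔ.le le_rfl (h.trans hs.2),
      intervalIntegral.integral_congr_uIoo (g := fun _ => 0)]
    · simp
    · intro τ hτ
      rw [Set.uIoo_of_le (by linarith)] at hτ
      have h := uOnOff_natCast_mul_add (η := η) hΔ k (s := τ - k * Δ)
        ⟨by linarith [hτ.1], by linarith [hτ.2, hs.2]⟩
      rw [add_sub_cancel, if_neg (by linarith [hτ.1])] at h
      exact h

theorem integral_uOnOff_natCast_mul (hη : η ∈ Set.Ioo (0 : ℝ) 1) (hΔ : 0 < Δ) (n : ℕ) :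
    ∫ τ in (0 : ℝ)..(n * Δ), uOnOff Δ η τ = n * (η * Δ) := by
  induction n with
  | zero => simp
  | succ n ih =>
    have hcycle := integral_uOnOff_cycle hη hΔ n (Set.right_mem_Icc.2 hΔ.le)
    rw [min_eq_right (by nlinarith [hη.2])] at hcycle
    rw [← intervalIntegral.integral_add_adjacent_intervals
      (intervalIntegrable_uOnOff Δ η _ (n * Δ)) (intervalIntegrable_uOnOff Δ η _ _), ih]
    push_cast
    rw [add_one_mul, hcycle]
    ring

/-- The cumulative green time up to `t` exceeds `η * t` by at most `η * (1 - η) * Δ`. -/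
theorem integral_uOnOff_mem_Icc (hη : η ∈ Set.Ioo (0 : ℝ) 1) (hΔ : 0 < Δ) {t : ℝ} (ht : 0 ≤ t) :
    ∫ τ in (0 : ℝ)..t, uOnOff Δ η τ ∈ Set.Icc (η * t) (η * t + η * (1 - η) * Δ) := by
  obtain ⟨n, s, hs, rfl⟩ : ∃ n : ℕ, ∃ s ∈ Set.Icc 0 Δ, t = n * Δ + s := by
    refine ⟨⌊t / Δ⌋₊, t - ⌊t / Δ⌋₊ * Δ, ⟨?_, ?_⟩, by ring⟩
    · have := (le_div_iff₀ hΔ).1 (Nat.floor_le (div_nonneg ht hΔ.le))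
      linarith
    · have := (div_lt_iff₀ hΔ).1 (Nat.lt_floor_add_one (t / Δ))
      linarith
  rw [← intervalIntegral.integral_add_adjacent_intervals
    (intervalIntegrable_uOnOff Δ η _ (n * Δ)) (intervalIntegrable_uOnOff Δ η _ _),
    integral_uOnOff_natCast_mul hη hΔ, integral_uOnOff_cycle hη hΔ n hs]
  obtain ⟨hη0, hη1⟩ := hη
  obtain ⟨hs0, hsΔ⟩ := hs
  rcases le_total s (η * Δ) with h | h
  · rw [min_eq_left h]
    constructor <;> nlinarith
  · rw [min_eq_right h]
    constructor <;> nlinarith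

end OnOffSignal

/-- Bound on the difference between the on-and-off downstream boundary condition
`∫₀ᵗ min{C₁,S} u_Δ` and the continuum one `η ∫₀ᵗ min{C₁,S}`, when the supply `S`
is sandwiched between `Y` and `X`. -/
theorem onOff_boundary_diff_bound (η Δ C₁ T X Y : ℝ)
    (hη : η ∈ Set.Ioo (0:ℝ) 1) (hΔ : 0 < Δ) (hC₁ : 0 < C₁)
    (hY : 0 ≤ Y) (hYX : Y ≤ X)
    (S : ℝ → ℝ) (hSmeas : Measurable S)
    (hS : ∀ τ ∈ Set.Icc (0:ℝ) T, Y ≤ S τ ∧ S τ ≤ X) :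
    ∀ t ∈ Set.Icc (0:ℝ) T,
      |(∫ τ in (0:ℝ)..t, min C₁ (S τ) * uOnOff Δ η τ) -
          η * ∫ τ in (0:ℝ)..t, min C₁ (S τ)|
        ≤ min C₁ (X - Y) * η * t + η * (1 - η) * Δ * min C₁ X := by
  rintro t ⟨ht0, htT⟩
  obtain ⟨hη0, hη1⟩ := hη
  obtain ⟨hJl, hJu⟩ := integral_uOnOff_mem_Icc ⟨hη0, hη1⟩ hΔ ht0
  set f : ℝ → ℝ := fun τ => min C₁ (S τ)
  set u := uOnOff Δ η
  set m := min C₁ Y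
  set M := min C₁ X
  have hm : 0 ≤ m := le_min hC₁.le hY
  have hmM : m ≤ M := min_le_min_left C₁ hYX
  have hD : M - m ≤ min C₁ (X - Y) := by
    refine le_min (by linarith [min_le_left C₁ X]) ?_
    rcases min_choice C₁ Y with h | h
    · linarith [min_le_left C₁ X]
    · linarith [min_le_right C₁ X]
  have hfm : ∀ τ ∈ Set.Icc 0 t, m ≤ f τ ∧ f τ ≤ M := fun τ hτ =>
    have h := hS τ ⟨hτ.1, hτ.2.trans htT⟩
    ⟨min_le_min_left _ h.1, min_le_min_left _ h.2⟩
  have hfmeas : Measurable f := measurable_const.min hSmeas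
  have hfi : IntervalIntegrable f MeasureTheory.volume 0 t :=
    intervalIntegrable_of_abs_le ht0 hfmeas (C := M) fun τ hτ => by
      have h := hfm τ (Set.Ioc_subset_Icc_self hτ)
      rw [abs_of_nonneg (hm.trans h.1)]
      exact h.2
  have hu01 : ∀ τ, u τ = 0 ∨ u τ = 1 := uOnOff_eq_zero_or_one Δ η
  have hui : IntervalIntegrable u MeasureTheory.volume 0 t := intervalIntegrable_uOnOff Δ η 0 t
  have hfui : IntervalIntegrable (fun τ => f τ * u τ) MeasureTheory.volume 0 t :=
    intervalIntegrable_of_abs_le ht0 (hfmeas.mul (measurable_uOnOff Δ η)) (C := M) fun τ hτ => by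
      have h := hfm τ (Set.Ioc_subset_Icc_self hτ)
      rcases hu01 τ with hu | hu
      · simpa [hu] using hm.trans hmM
      · simpa [hu, abs_of_nonneg (hm.trans h.1)] using h.2
  have haffine : ∀ a b : ℝ, IntervalIntegrable (fun τ => a * u τ + b) MeasureTheory.volume 0 t ∧
      ∫ τ in (0 : ℝ)..t, (a * u τ + b) = a * (∫ τ in (0 : ℝ)..t, u τ) + b * t := fun a b => by
    refine ⟨(hui.const_mul a).add intervalIntegrable_const, ?_⟩
    rw [intervalIntegral.integral_add (hui.const_mul a) intervalIntegrable_const,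
      intervalIntegral.integral_const_mul, intervalIntegral.integral_const]
    simp [mul_comm]
  have hgi : IntervalIntegrable (fun τ => f τ * u τ - η * f τ) MeasureTheory.volume 0 t :=
    hfui.sub (hfi.const_mul η)
  rw [← intervalIntegral.integral_const_mul,
    ← intervalIntegral.integral_sub hfui (hfi.const_mul η)]
  have hupper := intervalIntegral.integral_mono_on ht0 hgi
    (haffine (m + (M - m) * (1 - η)) (-(m * η))).1 fun τ hτ => by
      obtain ⟨h1, h2⟩ := hfm τ hτ
      rcases hu01 τ with hu | hu <;> rw [hu] <;> nlinarith
  have hlower := intervalIntegral.integral_mono_on ht0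
    (haffine (m + (M - m) * η) (-(m * η) - (M - m) * η)).1 hgi fun τ hτ => by
      obtain ⟨h1, h2⟩ := hfm τ hτ
      rcases hu01 τ with hu | hu <;> rw [hu] <;> nlinarith
  rw [(haffine _ _).2] at hupper hlower
  set J := ∫ τ in (0 : ℝ)..t, u τ
  have hDt : (M - m) * (η * t) ≤ min C₁ (X - Y) * (η * t) :=
    mul_le_mul_of_nonneg_right hD (by positivity)
  have hMm : 0 ≤ M - m := sub_nonneg.2 hmM
  have hηΔ : 0 ≤ η * (1 - η) * Δ := by
    have := sub_pos.2 hη1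
    positivity
  have hMJ : M * (J - η * t) ≤ M * (η * (1 - η) * Δ) :=
    mul_le_mul_of_nonneg_left (by linarith) (hm.trans hmM)
  have hmJ : 0 ≤ m * (J - η * t) := mul_nonneg hm (by linarith)
  have hDJ : 0 ≤ (M - m) * η * J :=
    mul_nonneg (by positivity) ((mul_nonneg hη0.le ht0).trans hJl)
  have hMηΔ : 0 ≤ M * (η * (1 - η) * Δ) := mul_nonneg (hm.trans hmM) hηΔ
  rw [abs_le]
  constructor <;> nlinarith
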